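/- arXiv:0912.3452 — 3 statements merged into one kernel-verified Lean document; each statement's English description precedes it below -/
import Mathlib

section
/- Let H be a Hopf quasigroup and M a right H-Hopf module with action (m,h) ↦ m·h and coaction ρ. Define the induced action m ⊳ h := (m₍₀₎·Sm₍₁₎)·(m₍₂₎h). Then M with the action ⊳ and the same coaction ρ is again a right H-Hopf module; that is, ⊳ is k-bilinear and unital, satisfies (m ⊳ h₍₁₎) ⊳ Sh₍₂₎ = mε(h) = (m ⊳ Sh₍₁₎) ⊳ h₍₂₎, and ρ(m ⊳ h) = m₍₀₎ ⊳ h₍₁₎ ⊗ m₍₁₎h₍₂₎. -/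
open TensorProduct

noncomputable section

/-- The componentwise product on `H ⊗[k] H` induced by a bilinear multiplication on `H`:
`(a ⊗ b) * (c ⊗ d) = a c ⊗ b d`. -/
def tmul2 (k : Type*) [Field k] (H : Type*) [AddCommGroup H] [Module k H]
    (mul : H →ₗ[k] H →ₗ[k] H) :
    H ⊗[k] H →ₗ[k] H ⊗[k] H →ₗ[k] H ⊗[k] H :=
  TensorProduct.curry
    ((TensorProduct.map (TensorProduct.lift mul) (TensorProduct.lift mul)).comp
      (TensorProduct.tensorTensorTensorComm k H H H H).toLinearMap)

/-- The common setup: a (not necessarily associative) unital algebra `H` with a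
(not necessarily coassociative) counital coalgebra structure, such that the coproduct
and the counit are multiplicative and unital. -/
structure BialgQ (k : Type*) [Field k] (H : Type*) [AddCommGroup H] [Module k H] where
  /-- the (bilinear, not necessarily associative) multiplication -/
  mul : H →ₗ[k] H →ₗ[k] H
  /-- the unit element -/
  one : H
  /-- the (not necessarily coassociative) comultiplication -/
  comul : H →ₗ[k] H ⊗[k] H
  /-- the counit -/
  counit : H →ₗ[k] k
  one_mul : ∀ h, mul one h = h
  mul_one : ∀ h, mul h one = h
  /-- counit law `(ε ⊗ id) ∘ Δ = id` -/
  counit_comul : ∀ h,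
    TensorProduct.lid k H (TensorProduct.map counit LinearMap.id (comul h)) = h
  /-- counit law `(id ⊗ ε) ∘ Δ = id` -/
  comul_counit : ∀ h,
    TensorProduct.rid k H (TensorProduct.map LinearMap.id counit (comul h)) = h
  /-- `Δ` is multiplicative -/
  comul_mul : ∀ g h, comul (mul g h) = tmul2 k H mul (comul g) (comul h)
  /-- `Δ` is unital -/
  comul_one : comul one = one ⊗ₜ[k] one
  /-- `ε` is multiplicative -/
  counit_mul : ∀ g h, counit (mul g h) = counit g * counit h
  /-- `ε` is unital -/
  counit_one : counit one = 1

namespace BialgQ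

variable {k : Type*} [Field k] {H : Type*} [AddCommGroup H] [Module k H] (D : BialgQ k H)

/-- The multiplication as a linear map on the tensor product. -/
def mulMap : H ⊗[k] H →ₗ[k] H := TensorProduct.lift D.mul

/-- The right Galois map `β : g ⊗ h ↦ g h₍₁₎ ⊗ h₍₂₎`. -/
def rGalois : H ⊗[k] H →ₗ[k] H ⊗[k] H :=
  (TensorProduct.map D.mulMap LinearMap.id).comp
    (((TensorProduct.assoc k H H H).symm.toLinearMap).comp
      (TensorProduct.map LinearMap.id D.comul))

/-- The left Galois map `γ : g ⊗ h ↦ g₍₁₎ ⊗ g₍₂₎ h`. -/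
def lGalois : H ⊗[k] H →ₗ[k] H ⊗[k] H :=
  (TensorProduct.map LinearMap.id D.mulMap).comp
    (((TensorProduct.assoc k H H H).toLinearMap).comp
      (TensorProduct.map D.comul LinearMap.id))

/-- `φ` is almost left `H`-linear: `φ(g ⊗ h) = (g ⊗ 1) · φ(1 ⊗ h)`. -/
def AlmostLeftLinear (φ : H ⊗[k] H →ₗ[k] H ⊗[k] H) : Prop :=
  ∀ g h : H, φ (g ⊗ₜ[k] h) = tmul2 k H D.mul (g ⊗ₜ[k] D.one) (φ (D.one ⊗ₜ[k] h))

/-- `φ` is almost right `H`-linear: `φ(g ⊗ h) = φ(g ⊗ 1) · (1 ⊗ h)`. -/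
def AlmostRightLinear (φ : H ⊗[k] H →ₗ[k] H ⊗[k] H) : Prop :=
  ∀ g h : H, φ (g ⊗ₜ[k] h) = tmul2 k H D.mul (φ (g ⊗ₜ[k] D.one)) (D.one ⊗ₜ[k] h)

/-- `φ` is almost right `H`-colinear: `φ(g ⊗ h) = (id ⊗ ε)(φ(g ⊗ h₍₁₎)) ⊗ h₍₂₎`. -/
def AlmostRightColinear (φ : H ⊗[k] H →ₗ[k] H ⊗[k] H) : Prop :=
  ∀ g h : H, φ (g ⊗ₜ[k] h) =
    TensorProduct.map
      ((TensorProduct.rid k H).toLinearMap.comp (TensorProduct.map LinearMap.id D.counit))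
      LinearMap.id
      (TensorProduct.map φ LinearMap.id
        ((TensorProduct.assoc k H H H).symm (g ⊗ₜ[k] D.comul h)))

/-- `φ` is almost left `H`-colinear: `φ(g ⊗ h) = g₍₁₎ ⊗ (ε ⊗ id)(φ(g₍₂₎ ⊗ h))`. -/
def AlmostLeftColinear (φ : H ⊗[k] H →ₗ[k] H ⊗[k] H) : Prop :=
  ∀ g h : H, φ (g ⊗ₜ[k] h) =
    TensorProduct.map LinearMap.id
      ((TensorProduct.lid k H).toLinearMap.comp (TensorProduct.map D.counit LinearMap.id))
      (TensorProduct.map LinearMap.id φ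
        ((TensorProduct.assoc k H H H) (D.comul g ⊗ₜ[k] h)))

/-- The candidate inverse `g ⊗ h ↦ g S(h₍₁₎) ⊗ h₍₂₎` of the right Galois map, built
from a linear map `S : H → H`. -/
def betaInvOf (S : H →ₗ[k] H) : H ⊗[k] H →ₗ[k] H ⊗[k] H :=
  (TensorProduct.map (D.mulMap.comp (TensorProduct.map LinearMap.id S)) LinearMap.id).comp
    (((TensorProduct.assoc k H H H).symm.toLinearMap).comp
      (TensorProduct.map LinearMap.id D.comul))

/-- The candidate inverse `g ⊗ h ↦ g₍₁₎ ⊗ (S g₍₂₎) h` of the left Galois map, built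
from a linear map `S : H → H`. -/
def gammaInvOf (S : H →ₗ[k] H) : H ⊗[k] H →ₗ[k] H ⊗[k] H :=
  (TensorProduct.map LinearMap.id (D.mulMap.comp (TensorProduct.map S LinearMap.id))).comp
    (((TensorProduct.assoc k H H H).toLinearMap).comp
      (TensorProduct.map D.comul LinearMap.id))

/-- The antipode produced from an inverse `φ` of the right Galois map:
`S h = (id ⊗ ε)(φ(1 ⊗ h))`. -/
def antipodeOf (φ : H ⊗[k] H →ₗ[k] H ⊗[k] H) : H →ₗ[k] H :=
  ((TensorProduct.rid k H).toLinearMap.comp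
    ((TensorProduct.map LinearMap.id D.counit).comp
      (φ.comp (TensorProduct.mk k H H D.one))))

end BialgQ

/-- A Hopf quasigroup. -/
structure HopfQuasigroup (k : Type*) [Field k] (H : Type*) [AddCommGroup H] [Module k H]
    extends BialgQ k H where
  /-- `Δ` is coassociative -/
  coassoc : ∀ h, TensorProduct.assoc k H H H
      (TensorProduct.map comul LinearMap.id (comul h)) =
    TensorProduct.map LinearMap.id comul (comul h)
  /-- the antipode -/
  S : H →ₗ[k] H
  /-- `(S h₍₁₎)(h₍₂₎ g) = ε(h) g` -/
  antipode₁ : ∀ h g, TensorProduct.lift mul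
      (TensorProduct.map S (TensorProduct.lift mul)
        (TensorProduct.assoc k H H H (comul h ⊗ₜ[k] g))) = counit h • g
  /-- `h₍₁₎((S h₍₂₎) g) = ε(h) g` -/
  antipode₂ : ∀ h g, TensorProduct.lift mul
      (TensorProduct.map LinearMap.id
        ((TensorProduct.lift mul).comp (TensorProduct.map S LinearMap.id))
        (TensorProduct.assoc k H H H (comul h ⊗ₜ[k] g))) = counit h • g
  /-- `(g h₍₁₎) S h₍₂₎ = ε(h) g` -/
  antipode₃ : ∀ g h, TensorProduct.lift mul
      (TensorProduct.map (TensorProduct.lift mul) S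
        ((TensorProduct.assoc k H H H).symm (g ⊗ₜ[k] comul h))) = counit h • g
  /-- `(g S h₍₁₎) h₍₂₎ = ε(h) g` -/
  antipode₄ : ∀ g h, TensorProduct.lift mul
      (TensorProduct.map ((TensorProduct.lift mul).comp (TensorProduct.map LinearMap.id S))
        LinearMap.id
        ((TensorProduct.assoc k H H H).symm (g ⊗ₜ[k] comul h))) = counit h • g

/-- A Hopf coquasigroup. -/
structure HopfCoquasigroup (k : Type*) [Field k] (H : Type*) [AddCommGroup H] [Module k H]
    extends BialgQ k H where
  /-- the multiplication is associative -/
  mul_assoc : ∀ g h l, mul (mul g h) l = mul g (mul h l)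
  /-- the antipode -/
  S : H →ₗ[k] H
  /-- `(S h₍₁₎) h₍₂₎₍₁₎ ⊗ h₍₂₎₍₂₎ = 1 ⊗ h` -/
  coantipode₁ : ∀ h,
    TensorProduct.map ((TensorProduct.lift mul).comp (TensorProduct.map S LinearMap.id))
      LinearMap.id
      ((TensorProduct.assoc k H H H).symm
        (TensorProduct.map LinearMap.id comul (comul h))) = one ⊗ₜ[k] h
  /-- `h₍₁₎ S(h₍₂₎₍₁₎) ⊗ h₍₂₎₍₂₎ = 1 ⊗ h` -/
  coantipode₂ : ∀ h,
    TensorProduct.map ((TensorProduct.lift mul).comp (TensorProduct.map LinearMap.id S))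
      LinearMap.id
      ((TensorProduct.assoc k H H H).symm
        (TensorProduct.map LinearMap.id comul (comul h))) = one ⊗ₜ[k] h
  /-- `h₍₁₎₍₁₎ ⊗ h₍₁₎₍₂₎ S h₍₂₎ = h ⊗ 1` -/
  coantipode₃ : ∀ h,
    TensorProduct.map LinearMap.id
      ((TensorProduct.lift mul).comp (TensorProduct.map LinearMap.id S))
      (TensorProduct.assoc k H H H
        (TensorProduct.map comul LinearMap.id (comul h))) = h ⊗ₜ[k] one
  /-- `h₍₁₎₍₁₎ ⊗ (S h₍₁₎₍₂₎) h₍₂₎ = h ⊗ 1` -/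
  coantipode₄ : ∀ h,
    TensorProduct.map LinearMap.id
      ((TensorProduct.lift mul).comp (TensorProduct.map S LinearMap.id))
      (TensorProduct.assoc k H H H
        (TensorProduct.map comul LinearMap.id (comul h))) = h ⊗ₜ[k] one

namespace HopfQuasigroup

variable {k : Type*} [Field k] {H : Type*} [AddCommGroup H] [Module k H]
  (Q : HopfQuasigroup k H)

/-- `M` is a right `H`-Hopf module over the Hopf quasigroup `Q`, with (bilinear, unital)
action `act` and (coassociative, counital) coaction `ρ`, satisfying
`(m·h₍₁₎)·Sh₍₂₎ = ε(h) m = (m·Sh₍₁₎)·h₍₂₎` and `ρ(m·h) = m₍₀₎·h₍₁₎ ⊗ m₍₁₎h₍₂₎`. -/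
def IsHopfModule {M : Type*} [AddCommGroup M] [Module k M]
    (act : M ⊗[k] H →ₗ[k] M) (ρ : M →ₗ[k] M ⊗[k] H) : Prop :=
  (∀ m, act (m ⊗ₜ[k] Q.one) = m) ∧
  (∀ m, TensorProduct.assoc k M H H (TensorProduct.map ρ LinearMap.id (ρ m)) =
      TensorProduct.map LinearMap.id Q.comul (ρ m)) ∧
  (∀ m, TensorProduct.rid k M (TensorProduct.map LinearMap.id Q.counit (ρ m)) = m) ∧
  (∀ m h, act (TensorProduct.map act Q.S
      ((TensorProduct.assoc k M H H).symm (m ⊗ₜ[k] Q.comul h))) = Q.counit h • m) ∧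
  (∀ m h, act (TensorProduct.map (act.comp (TensorProduct.map LinearMap.id Q.S)) LinearMap.id
      ((TensorProduct.assoc k M H H).symm (m ⊗ₜ[k] Q.comul h))) = Q.counit h • m) ∧
  (∀ m h, ρ (act (m ⊗ₜ[k] h)) =
      TensorProduct.map act (TensorProduct.lift Q.mul)
        (TensorProduct.tensorTensorTensorComm k M H H H (ρ m ⊗ₜ[k] Q.comul h)))

/-- `m ↦ (m₍₀₎ · S m₍₁₎) ⊗ m₍₂₎`. -/
def coinvPart {M : Type*} [AddCommGroup M] [Module k M]
    (act : M ⊗[k] H →ₗ[k] M) (ρ : M →ₗ[k] M ⊗[k] H) : M →ₗ[k] M ⊗[k] H :=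
  (TensorProduct.map (act.comp (TensorProduct.map LinearMap.id Q.S)) LinearMap.id).comp
    ((TensorProduct.map ρ LinearMap.id).comp ρ)

/-- The induced action `m ⊳ h = (m₍₀₎ · S m₍₁₎) · (m₍₂₎ h)` of a right Hopf module. -/
def inducedAct {M : Type*} [AddCommGroup M] [Module k M]
    (act : M ⊗[k] H →ₗ[k] M) (ρ : M →ₗ[k] M ⊗[k] H) : M ⊗[k] H →ₗ[k] M :=
  act.comp ((TensorProduct.map LinearMap.id (TensorProduct.lift Q.mul)).comp
    (((TensorProduct.assoc k M H H).toLinearMap).comp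
      (TensorProduct.map (Q.coinvPart act ρ) LinearMap.id)))

/-- The free action `(m ⊗ h) · g = m ⊗ h g` on `M ⊗ H`. -/
def freeAct (M : Type*) [AddCommGroup M] [Module k M] :
    (M ⊗[k] H) ⊗[k] H →ₗ[k] M ⊗[k] H :=
  (TensorProduct.map LinearMap.id (TensorProduct.lift Q.mul)).comp
    (TensorProduct.assoc k M H H).toLinearMap

/-- The coaction `id ⊗ Δ : m ⊗ h ↦ m ⊗ h₍₁₎ ⊗ h₍₂₎` on `M ⊗ H`. -/
def freeCoact (M : Type*) [AddCommGroup M] [Module k M] :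
    M ⊗[k] H →ₗ[k] (M ⊗[k] H) ⊗[k] H :=
  ((TensorProduct.assoc k M H H).symm.toLinearMap).comp
    (TensorProduct.map LinearMap.id Q.comul)

/-- The diagonal action `(m ⊗ h) · g = m · g₍₁₎ ⊗ h g₍₂₎` on `M ⊗ H`. -/
def diagAct {M : Type*} [AddCommGroup M] [Module k M]
    (act : M ⊗[k] H →ₗ[k] M) : (M ⊗[k] H) ⊗[k] H →ₗ[k] M ⊗[k] H :=
  (TensorProduct.map act (TensorProduct.lift Q.mul)).comp
    (((TensorProduct.tensorTensorTensorComm k M H H H).toLinearMap).comp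
      (TensorProduct.map LinearMap.id Q.comul))

/-- The coinvariants `M^{coH} = {m | ρ(m) = m ⊗ 1}` of a right `H`-comodule. -/
def coinvariants {M : Type*} [AddCommGroup M] [Module k M]
    (ρ : M →ₗ[k] M ⊗[k] H) : Submodule k M :=
  LinearMap.ker (ρ - (TensorProduct.mk k M H).flip Q.one)

end HopfQuasigroup

namespace HopfCoquasigroup

variable {k : Type*} [Field k] {H : Type*} [AddCommGroup H] [Module k H]
  (Q : HopfCoquasigroup k H)

/-- `M` is a right `H`-Hopf module over the Hopf coquasigroup `Q`, with (bilinear,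
associative, unital) action `act` and (counital, not necessarily coassociative)
coaction `ρ`, satisfying `m₍₀₎₍₀₎ ⊗ m₍₀₎₍₁₎ S m₍₁₎ = m ⊗ 1 = m₍₀₎₍₀₎ ⊗ (S m₍₀₎₍₁₎) m₍₁₎`
and `ρ(m·h) = m₍₀₎·h₍₁₎ ⊗ m₍₁₎h₍₂₎`. -/
def IsHopfModule {M : Type*} [AddCommGroup M] [Module k M]
    (act : M ⊗[k] H →ₗ[k] M) (ρ : M →ₗ[k] M ⊗[k] H) : Prop :=
  (∀ m, act (m ⊗ₜ[k] Q.one) = m) ∧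
  (∀ m g h, act (act (m ⊗ₜ[k] g) ⊗ₜ[k] h) = act (m ⊗ₜ[k] Q.mul g h)) ∧
  (∀ m, TensorProduct.rid k M (TensorProduct.map LinearMap.id Q.counit (ρ m)) = m) ∧
  (∀ m, TensorProduct.map LinearMap.id
      ((TensorProduct.lift Q.mul).comp (TensorProduct.map LinearMap.id Q.S))
      (TensorProduct.assoc k M H H (TensorProduct.map ρ LinearMap.id (ρ m)))
      = m ⊗ₜ[k] Q.one) ∧
  (∀ m, TensorProduct.map LinearMap.id
      ((TensorProduct.lift Q.mul).comp (TensorProduct.map Q.S LinearMap.id))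
      (TensorProduct.assoc k M H H (TensorProduct.map ρ LinearMap.id (ρ m)))
      = m ⊗ₜ[k] Q.one) ∧
  (∀ m h, ρ (act (m ⊗ₜ[k] h)) =
      TensorProduct.map act (TensorProduct.lift Q.mul)
        (TensorProduct.tensorTensorTensorComm k M H H H (ρ m ⊗ₜ[k] Q.comul h)))

/-- The induced coaction `λ(m) = ((m₍₀₎₍₀₎ · S m₍₀₎₍₁₎) · m₍₁₎₍₁₎) ⊗ m₍₁₎₍₂₎`. -/
def inducedCoact {M : Type*} [AddCommGroup M] [Module k M]
    (act : M ⊗[k] H →ₗ[k] M) (ρ : M →ₗ[k] M ⊗[k] H) : M →ₗ[k] M ⊗[k] H :=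
  (TensorProduct.map act LinearMap.id).comp
    (((TensorProduct.assoc k M H H).symm.toLinearMap).comp
      ((TensorProduct.map (act.comp (TensorProduct.map LinearMap.id Q.S)) LinearMap.id).comp
        ((TensorProduct.map ρ Q.comul).comp ρ)))

end HopfCoquasigroup

namespace HopfQuasigroup

open LinearMap

variable {k : Type*} [Field k] {H : Type*} [AddCommGroup H] [Module k H]
  (Q : HopfQuasigroup k H) {M : Type*} [AddCommGroup M] [Module k M]
  (act : M ⊗[k] H →ₗ[k] M) (ρ : M →ₗ[k] M ⊗[k] H)

/-- The projection `m ↦ m₍₀₎ · S m₍₁₎` onto the coinvariants. -/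
def coinvProj : M →ₗ[k] M :=
  act.comp ((TensorProduct.map LinearMap.id Q.S).comp ρ)

lemma coinvPart_apply (m : M) :
    Q.coinvPart act ρ m = TensorProduct.map (Q.coinvProj act ρ) LinearMap.id (ρ m) := by
  rw [coinvPart, comp_apply, comp_apply, ← comp_apply, ← TensorProduct.map_comp]
  rfl

lemma inducedAct_tmul (m : M) (h : H) :
    Q.inducedAct act ρ (m ⊗ₜ[k] h) =
      act (TensorProduct.map (Q.coinvProj act ρ) (Q.mul.flip h) (ρ m)) := by
  simp only [inducedAct, comp_apply, LinearEquiv.coe_coe, TensorProduct.map_tmul, id_apply,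
    coinvPart_apply]
  congr 1
  induction ρ m with
  | zero => simp
  | tmul n b => simp
  | add x y hx hy => simp only [map_add, TensorProduct.add_tmul, hx, hy]

/-- `g h₍₁₎ S h₍₂₎ ⊗ h₍₃₎ = g ⊗ h`. -/
lemma betaInvOf_map_mul_comul (g h : H) :
    Q.betaInvOf Q.S (TensorProduct.map (Q.mul g) LinearMap.id (Q.comul h)) = g ⊗ₜ[k] h := by
  have key : ∀ y : H ⊗[k] H,
      Q.betaInvOf Q.S (TensorProduct.map (Q.mul g) LinearMap.id y) =
        TensorProduct.map (TensorProduct.lift Q.mul) LinearMap.id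
          (TensorProduct.map (TensorProduct.map (Q.mul g) Q.S) LinearMap.id
            ((TensorProduct.assoc k H H H).symm
              (TensorProduct.map LinearMap.id Q.comul y))) := by
    intro y
    induction y with
    | zero => simp
    | add x y hx hy => simp only [map_add, hx, hy]
    | tmul a b =>
      simp only [BialgQ.betaInvOf, BialgQ.mulMap, comp_apply, LinearEquiv.coe_coe,
        TensorProduct.map_tmul, id_apply]
      induction Q.comul b with
      | zero => simp
      | add x y hx hy => simp only [map_add, TensorProduct.tmul_add, hx, hy]
      | tmul c d => simp
  have anti : ∀ y : H ⊗[k] H,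
      TensorProduct.map (TensorProduct.lift Q.mul) LinearMap.id
          (TensorProduct.map (TensorProduct.map (Q.mul g) Q.S) LinearMap.id
            (TensorProduct.map Q.comul LinearMap.id y)) =
        g ⊗ₜ[k] TensorProduct.lid k H (TensorProduct.map Q.counit LinearMap.id y) := by
    intro y
    induction y with
    | zero => simp
    | add x y hx hy => simp only [map_add, TensorProduct.tmul_add, hx, hy]
    | tmul a b =>
      have ha : TensorProduct.lift Q.mul (TensorProduct.map (Q.mul g) Q.S (Q.comul a)) =
          Q.counit a • g := by
        rw [← Q.antipode₃ g a]
        induction Q.comul a with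
        | zero => simp
        | add x y hx hy => simp only [map_add, TensorProduct.tmul_add, hx, hy]
        | tmul c d => simp
      simp [ha, TensorProduct.smul_tmul]
  rw [key, ← Q.coassoc, LinearEquiv.symm_apply_apply, anti, Q.counit_comul]

lemma betaInvOf_comul (h : H) : Q.betaInvOf Q.S (Q.comul h) = Q.one ⊗ₜ[k] h := by
  have hone : Q.mul Q.one = LinearMap.id := LinearMap.ext Q.one_mul
  simpa [hone] using Q.betaInvOf_map_mul_comul Q.one h

/-- The map `m ⊗ (g ⊗ h) ↦ m · S h ⊗ g`. -/
def swapAct : M ⊗[k] (H ⊗[k] H) →ₗ[k] M ⊗[k] H :=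
  (TensorProduct.map (act.comp (TensorProduct.map LinearMap.id Q.S)) LinearMap.id).comp
    ((TensorProduct.assoc k M H H).symm.toLinearMap.comp
      (TensorProduct.map LinearMap.id (TensorProduct.comm k H H).toLinearMap))

/-- The map `(m ⊗ g) ⊗ h ↦ m · S h₍₂₎ ⊗ g S h₍₁₎`, the diagonal action of the antipode. -/
def diagActAntipode : (M ⊗[k] H) ⊗[k] H →ₗ[k] M ⊗[k] H :=
  (Q.swapAct act).comp
    ((TensorProduct.map LinearMap.id (Q.betaInvOf Q.S)).comp
      (TensorProduct.assoc k M H H).toLinearMap)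

variable {act ρ}

lemma diagActAntipode_diagAct (hM : Q.IsHopfModule act ρ) (x : M ⊗[k] H) (h : H) :
    Q.diagActAntipode act (TensorProduct.map (Q.diagAct act) LinearMap.id
      ((TensorProduct.assoc k (M ⊗[k] H) H H).symm (x ⊗ₜ[k] Q.comul h))) =
      Q.counit h • x := by
  obtain ⟨-, -, -, hact, -, -⟩ := hM
  induction x with
  | zero => simp
  | add x y hx hy => simp only [TensorProduct.add_tmul, map_add, hx, hy, smul_add]
  | tmul m g =>
    have hdiag : ∀ y : H ⊗[k] H,
        TensorProduct.assoc k M H H (TensorProduct.map (Q.diagAct act) LinearMap.id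
          ((TensorProduct.assoc k (M ⊗[k] H) H H).symm ((m ⊗ₜ[k] g) ⊗ₜ[k] y))) =
        TensorProduct.map (act.comp (TensorProduct.mk k M H m))
          (TensorProduct.map (Q.mul g) LinearMap.id)
          (TensorProduct.assoc k H H H (TensorProduct.map Q.comul LinearMap.id y)) := by
      intro y
      induction y with
      | zero => simp
      | add x y hx hy => simp only [map_add, TensorProduct.tmul_add, hx, hy]
      | tmul a b =>
        simp only [diagAct, TensorProduct.assoc_symm_tmul, TensorProduct.map_tmul, comp_apply,
          LinearEquiv.coe_coe, id_apply]
        induction Q.comul a with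
        | zero => simp
        | add x y hx hy =>
          simp only [map_add, TensorProduct.tmul_add, TensorProduct.add_tmul, hx, hy]
        | tmul c d => simp
    have hbeta : ∀ y : H ⊗[k] H,
        TensorProduct.map LinearMap.id (Q.betaInvOf Q.S)
          (TensorProduct.map (act.comp (TensorProduct.mk k M H m))
            (TensorProduct.map (Q.mul g) LinearMap.id)
            (TensorProduct.map LinearMap.id Q.comul y)) =
        TensorProduct.map (act.comp (TensorProduct.mk k M H m)) (TensorProduct.mk k H H g) y := by
      intro y
      induction y with
      | zero => simp
      | add x y hx hy => simp only [map_add, hx, hy]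
      | tmul a b => simp [betaInvOf_map_mul_comul]
    have hswap : ∀ y : H ⊗[k] H,
        Q.swapAct act (TensorProduct.map (act.comp (TensorProduct.mk k M H m))
          (TensorProduct.mk k H H g) y) =
        act (TensorProduct.map act Q.S
          ((TensorProduct.assoc k M H H).symm (m ⊗ₜ[k] y))) ⊗ₜ[k] g := by
      intro y
      induction y with
      | zero => simp
      | add x y hx hy => simp only [map_add, TensorProduct.tmul_add, TensorProduct.add_tmul, hx, hy]
      | tmul a b => simp [swapAct]
    simp only [diagActAntipode, comp_apply, LinearEquiv.coe_coe]
    rw [hdiag, Q.coassoc, hbeta, hswap, hact, TensorProduct.smul_tmul']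

lemma diagActAntipode_coact (hM : Q.IsHopfModule act ρ) (m : M) :
    Q.diagActAntipode act (TensorProduct.map ρ LinearMap.id (ρ m)) =
      Q.coinvProj act ρ m ⊗ₜ[k] Q.one := by
  obtain ⟨-, hcoassoc, -⟩ := hM
  simp only [diagActAntipode, coinvProj, comp_apply, LinearEquiv.coe_coe]
  rw [hcoassoc]
  induction ρ m with
  | zero => simp
  | add x y hx hy => simp only [map_add, TensorProduct.add_tmul, hx, hy]
  | tmul n b => simp [betaInvOf_comul, swapAct]

lemma rid_map_counit_coact (hM : Q.IsHopfModule act ρ) (m : M)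
    {N : Type*} [AddCommGroup N] [Module k N] (f : M →ₗ[k] N) :
    TensorProduct.rid k N (TensorProduct.map f Q.counit (ρ m)) = f m := by
  obtain ⟨-, -, hcounit, -⟩ := hM
  conv_rhs => rw [← hcounit m]
  induction ρ m with
  | zero => simp
  | add x y hx hy => simp only [map_add, hx, hy]
  | tmul n b => simp

/-- `(m₍₀₎ · S m₍₁₎) · m₍₂₎ = m`. -/
lemma act_coinvPart (hM : Q.IsHopfModule act ρ) (m : M) : act (Q.coinvPart act ρ m) = m := by
  have hcoassoc := hM.2.1
  have hact := hM.2.2.2.2.1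
  rw [coinvPart, comp_apply, comp_apply,
    (LinearEquiv.eq_symm_apply _).2 (hcoassoc m)]
  conv_rhs => rw [← hM.2.2.1 m]
  induction ρ m with
  | zero => simp
  | add x y hx hy => simp only [map_add, hx, hy]
  | tmul n b => simp [hact]

lemma coact_act (hM : Q.IsHopfModule act ρ) (x : M ⊗[k] H) :
    ρ (act x) = Q.diagAct act (TensorProduct.map ρ LinearMap.id x) := by
  have hcoact := hM.2.2.2.2.2
  induction x with
  | zero => simp
  | add x y hx hy => simp only [map_add, hx, hy]
  | tmul m h => simp [hcoact, diagAct]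

/-- The elements `m₍₀₎ · S m₍₁₎` are coinvariant. -/
lemma coact_coinvProj (hM : Q.IsHopfModule act ρ) (m : M) :
    ρ (Q.coinvProj act ρ m) = Q.coinvProj act ρ m ⊗ₜ[k] Q.one := by
  have hcoassoc := hM.2.1
  have split : ∀ x : M ⊗[k] H,
      TensorProduct.map ρ LinearMap.id x =
      TensorProduct.map (Q.diagAct act) LinearMap.id
        (TensorProduct.map (TensorProduct.map (ρ.comp (Q.coinvProj act ρ)) LinearMap.id)
          LinearMap.id (TensorProduct.map ρ LinearMap.id x)) := by
    intro x
    induction x with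
    | zero => simp
    | add x y hx hy => simp only [map_add]; rw [← hx, ← hy]
    | tmul n b =>
      simp only [TensorProduct.map_tmul, id_apply]
      congr 1
      conv_lhs => rw [← Q.act_coinvPart hM n, Q.coact_act hM, coinvPart_apply]
      rw [← comp_apply (TensorProduct.map ρ _), ← TensorProduct.map_comp, id_comp]
  have collapse : ∀ x : M ⊗[k] H,
      Q.diagActAntipode act (TensorProduct.map (Q.diagAct act) LinearMap.id
        (TensorProduct.map (TensorProduct.map (ρ.comp (Q.coinvProj act ρ)) LinearMap.id)
          LinearMap.id ((TensorProduct.assoc k M H H).symm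
            (TensorProduct.map LinearMap.id Q.comul x)))) =
      TensorProduct.rid k (M ⊗[k] H)
        (TensorProduct.map (ρ.comp (Q.coinvProj act ρ)) Q.counit x) := by
    intro x
    induction x with
    | zero => simp
    | add x y hx hy => simp only [map_add, hx, hy]
    | tmul n b =>
      simp only [TensorProduct.map_tmul, id_apply, TensorProduct.rid_tmul,
        ← Q.diagActAntipode_diagAct hM]
      congr 2
      induction Q.comul b with
      | zero => simp
      | add x y hx hy => simp only [map_add, TensorProduct.tmul_add, hx, hy]
      | tmul c d => simp
  rw [← Q.diagActAntipode_coact hM, split, (LinearEquiv.eq_symm_apply _).2 (hcoassoc m),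
    collapse, Q.rid_map_counit_coact hM, comp_apply]

lemma coact_act_coinvProj (hM : Q.IsHopfModule act ρ) (m : M) (h : H) :
    ρ (act (Q.coinvProj act ρ m ⊗ₜ[k] h)) =
      TensorProduct.map act LinearMap.id
        ((TensorProduct.assoc k M H H).symm (Q.coinvProj act ρ m ⊗ₜ[k] Q.comul h)) := by
  have hcoact := hM.2.2.2.2.2
  rw [hcoact, Q.coact_coinvProj hM]
  induction Q.comul h with
  | zero => simp
  | add x y hx hy => simp only [map_add, TensorProduct.tmul_add, hx, hy]
  | tmul a b => simp [Q.one_mul]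

lemma coinvProj_act_coinvProj (hM : Q.IsHopfModule act ρ) (m : M) (h : H) :
    Q.coinvProj act ρ (act (Q.coinvProj act ρ m ⊗ₜ[k] h)) =
      Q.counit h • Q.coinvProj act ρ m := by
  have hact := hM.2.2.2.1
  rw [coinvProj, comp_apply, comp_apply, ← coinvProj, Q.coact_act_coinvProj hM, ← hact]
  congr 1
  rw [← comp_apply, ← TensorProduct.map_comp, id_comp, comp_id]

lemma coinvPart_act_map_coinvProj (hM : Q.IsHopfModule act ρ) (x : M ⊗[k] H) :
    Q.coinvPart act ρ (act (TensorProduct.map (Q.coinvProj act ρ) LinearMap.id x)) =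
      TensorProduct.map (Q.coinvProj act ρ) LinearMap.id x := by
  induction x with
  | zero => simp
  | add x y hx hy => simp only [map_add, hx, hy]
  | tmul m h =>
    simp only [TensorProduct.map_tmul, id_apply, coinvPart_apply, Q.coact_act_coinvProj hM]
    conv_rhs => rw [← Q.counit_comul h]
    induction Q.comul h with
    | zero => simp
    | add x y hx hy => simp only [map_add, TensorProduct.tmul_add, hx, hy]
    | tmul a b => simp [Q.coinvProj_act_coinvProj hM, TensorProduct.smul_tmul]

/-- `(m ⊳ h) ⊳ g = (m₍₀₎ · S m₍₁₎) · ((m₍₂₎ h) g)`. -/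
lemma inducedAct_inducedAct (hM : Q.IsHopfModule act ρ) (m : M) (h g : H) :
    Q.inducedAct act ρ (Q.inducedAct act ρ (m ⊗ₜ[k] h) ⊗ₜ[k] g) =
      act (TensorProduct.map (Q.coinvProj act ρ) (Q.mul.flip g ∘ₗ Q.mul.flip h) (ρ m)) := by
  have hsplit : ∀ (f : H →ₗ[k] H) (x : M ⊗[k] H),
      TensorProduct.map (Q.coinvProj act ρ) f x =
        TensorProduct.map LinearMap.id f
          (TensorProduct.map (Q.coinvProj act ρ) LinearMap.id x) := by
    intro f x
    rw [← comp_apply, ← TensorProduct.map_comp, id_comp, comp_id]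
  have hsplit' : ∀ (f : H →ₗ[k] H) (x : M ⊗[k] H),
      TensorProduct.map (Q.coinvProj act ρ) f x =
        TensorProduct.map (Q.coinvProj act ρ) LinearMap.id
          (TensorProduct.map LinearMap.id f x) := by
    intro f x
    rw [← comp_apply, ← TensorProduct.map_comp, id_comp, comp_id]
  rw [inducedAct_tmul, hsplit, ← coinvPart_apply, inducedAct_tmul, hsplit',
    Q.coinvPart_act_map_coinvProj hM, ← hsplit', ← comp_apply (TensorProduct.map _ _),
    ← TensorProduct.map_comp, id_comp]

lemma act_map_coinvProj (hM : Q.IsHopfModule act ρ) (m : M) :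
    act (TensorProduct.map (Q.coinvProj act ρ) LinearMap.id (ρ m)) = m := by
  rw [← coinvPart_apply, Q.act_coinvPart hM]

lemma inducedAct_one (hM : Q.IsHopfModule act ρ) (m : M) : Q.inducedAct act ρ (m ⊗ₜ[k] Q.one) = m := by
  have hone : Q.mul.flip Q.one = LinearMap.id := LinearMap.ext Q.mul_one
  rw [inducedAct_tmul, hone, Q.act_map_coinvProj hM]

lemma inducedAct_antipode_right (hM : Q.IsHopfModule act ρ) (m : M) (h : H) :
    Q.inducedAct act ρ (TensorProduct.map (Q.inducedAct act ρ) Q.S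
      ((TensorProduct.assoc k M H H).symm (m ⊗ₜ[k] Q.comul h))) = Q.counit h • m := by
  have key : ∀ y : H ⊗[k] H,
      Q.inducedAct act ρ (TensorProduct.map (Q.inducedAct act ρ) Q.S
        ((TensorProduct.assoc k M H H).symm (m ⊗ₜ[k] y))) =
      act (TensorProduct.map (Q.coinvProj act ρ)
        (TensorProduct.lift Q.mul ∘ₗ TensorProduct.map (TensorProduct.lift Q.mul) Q.S ∘ₗ
          (TensorProduct.assoc k H H H).symm.toLinearMap ∘ₗ
            (TensorProduct.mk k H (H ⊗[k] H)).flip y) (ρ m)) := by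
    intro y
    induction y with
    | zero => simp
    | add x y hx hy =>
      simp only [map_add, TensorProduct.tmul_add, hx, hy, comp_add, TensorProduct.map_add_right,
        LinearMap.add_apply]
    | tmul a b =>
      simp only [TensorProduct.assoc_symm_tmul, TensorProduct.map_tmul,
        Q.inducedAct_inducedAct hM]
      congr 3
  have hanti : TensorProduct.lift Q.mul ∘ₗ TensorProduct.map (TensorProduct.lift Q.mul) Q.S ∘ₗ
      (TensorProduct.assoc k H H H).symm.toLinearMap ∘ₗ
        (TensorProduct.mk k H (H ⊗[k] H)).flip (Q.comul h) = Q.counit h • LinearMap.id :=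
    LinearMap.ext fun g => Q.antipode₃ g h
  rw [key, hanti, TensorProduct.map_smul_right, LinearMap.smul_apply, map_smul,
    Q.act_map_coinvProj hM]

lemma inducedAct_antipode_left (hM : Q.IsHopfModule act ρ) (m : M) (h : H) :
    Q.inducedAct act ρ (TensorProduct.map
      ((Q.inducedAct act ρ).comp (TensorProduct.map LinearMap.id Q.S)) LinearMap.id
      ((TensorProduct.assoc k M H H).symm (m ⊗ₜ[k] Q.comul h))) = Q.counit h • m := by
  have key : ∀ y : H ⊗[k] H,
      Q.inducedAct act ρ (TensorProduct.map
        ((Q.inducedAct act ρ).comp (TensorProduct.map LinearMap.id Q.S)) LinearMap.id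
        ((TensorProduct.assoc k M H H).symm (m ⊗ₜ[k] y))) =
      act (TensorProduct.map (Q.coinvProj act ρ)
        (TensorProduct.lift Q.mul ∘ₗ TensorProduct.map
            ((TensorProduct.lift Q.mul).comp (TensorProduct.map LinearMap.id Q.S))
            LinearMap.id ∘ₗ
          (TensorProduct.assoc k H H H).symm.toLinearMap ∘ₗ
            (TensorProduct.mk k H (H ⊗[k] H)).flip y) (ρ m)) := by
    intro y
    induction y with
    | zero => simp
    | add x y hx hy =>
      simp only [map_add, TensorProduct.tmul_add, hx, hy, comp_add, TensorProduct.map_add_right,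
        LinearMap.add_apply]
    | tmul a b =>
      simp only [TensorProduct.assoc_symm_tmul, TensorProduct.map_tmul, comp_apply, id_apply,
        Q.inducedAct_inducedAct hM]
      congr 3
  have hanti : TensorProduct.lift Q.mul ∘ₗ TensorProduct.map
        ((TensorProduct.lift Q.mul).comp (TensorProduct.map LinearMap.id Q.S))
        LinearMap.id ∘ₗ
      (TensorProduct.assoc k H H H).symm.toLinearMap ∘ₗ
        (TensorProduct.mk k H (H ⊗[k] H)).flip (Q.comul h) = Q.counit h • LinearMap.id :=
    LinearMap.ext fun g => Q.antipode₄ g h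
  rw [key, hanti, TensorProduct.map_smul_right, LinearMap.smul_apply, map_smul,
    Q.act_map_coinvProj hM]

lemma coact_inducedAct (hM : Q.IsHopfModule act ρ) (m : M) (h : H) :
    ρ (Q.inducedAct act ρ (m ⊗ₜ[k] h)) =
      TensorProduct.map (Q.inducedAct act ρ) (TensorProduct.lift Q.mul)
        (TensorProduct.tensorTensorTensorComm k M H H H (ρ m ⊗ₜ[k] Q.comul h)) := by
  have hcoassoc := hM.2.1
  have hright : ∀ (x : M ⊗[k] H) (y : H ⊗[k] H),
      TensorProduct.map (Q.inducedAct act ρ) (TensorProduct.lift Q.mul)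
        (TensorProduct.tensorTensorTensorComm k M H H H (x ⊗ₜ[k] y)) =
      TensorProduct.map act LinearMap.id ((TensorProduct.assoc k M H H).symm
        (TensorProduct.map (Q.coinvProj act ρ) ((tmul2 k H Q.mul).flip y)
          (TensorProduct.assoc k M H H (TensorProduct.map ρ LinearMap.id x)))) := by
    intro x y
    induction x with
    | zero => simp
    | add x y hx hy => simp only [map_add, TensorProduct.add_tmul, hx, hy]
    | tmul n b =>
      induction y with
      | zero => simp
      | add x y hx hy =>
        simp only [map_add, TensorProduct.tmul_add, hx, hy, TensorProduct.map_add_right,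
          LinearMap.add_apply]
      | tmul c d =>
        simp only [TensorProduct.tensorTensorTensorComm_tmul, TensorProduct.map_tmul,
          inducedAct_tmul, id_apply]
        induction ρ n with
        | zero => simp
        | add x y hx hy => simp only [map_add, TensorProduct.add_tmul, hx, hy]
        | tmul p q => simp [tmul2]
  rw [hright, hcoassoc, inducedAct_tmul]
  induction ρ m with
  | zero => simp
  | add x y hx hy => simp only [map_add, hx, hy]
  | tmul n b => simp [Q.coact_act_coinvProj hM, Q.comul_mul]

end HopfQuasigroup

/-- For a right Hopf module `M` over a Hopf quasigroup, `M` with the induced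
action `m ⊳ h = (m₍₀₎ · S m₍₁₎) · (m₍₂₎ h)` and the same coaction is again a right
`H`-Hopf module. -/
theorem stmt9 {k : Type*} [Field k] {H : Type*} [AddCommGroup H] [Module k H]
    (Q : HopfQuasigroup k H) {M : Type*} [AddCommGroup M] [Module k M]
    (act : M ⊗[k] H →ₗ[k] M) (ρ : M →ₗ[k] M ⊗[k] H)
    (hM : Q.IsHopfModule act ρ) :
    Q.IsHopfModule (Q.inducedAct act ρ) ρ := by
  exact ⟨Q.inducedAct_one hM, hM.2.1, hM.2.2.1, Q.inducedAct_antipode_right hM,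
    Q.inducedAct_antipode_left hM, Q.coact_inducedAct hM⟩
end
end

section
/- Let H be a Hopf quasigroup. Regard H⊗H as a right H-Hopf module in two ways: (i) the 'free' structure with action (g⊗h)·k = g⊗hk and coaction g⊗h ↦ g⊗h₍₁₎⊗h₍₂₎; (ii) the 'diagonal' structure with action (g⊗h)·k = gk₍₁₎ ⊗ hk₍₂₎ and coaction g⊗h ↦ g⊗h₍₁₎⊗h₍₂₎. Then the right Galois map β : H⊗H → H⊗H, g⊗h ↦ gh₍₁₎⊗h₍₂₎, is an isomorphism of right H-Hopf modules from (i) to (ii): it is bijective, right H-colinear, and H-quasilinear (intertwines the induced actions). Moreover, the coinvariants of the diagonal structure are (H⊗H)^{coH} = H⊗1. -/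
open TensorProduct

noncomputable section

namespace HopfQuasigroup

variable {k : Type*} [Field k] {H : Type*} [AddCommGroup H] [Module k H]
  (Q : HopfQuasigroup k H) {M : Type*} [AddCommGroup M] [Module k M]

/-- The Galois-type map `m ⊗ h ↦ m · h₍₁₎ ⊗ h₍₂₎` of a bilinear action on `M`. -/
def galois (act : M ⊗[k] H →ₗ[k] M) : M ⊗[k] H →ₗ[k] M ⊗[k] H :=
  (TensorProduct.map act LinearMap.id).comp (Q.freeCoact M)

theorem galois_tmul (act : M ⊗[k] H →ₗ[k] M) (m : M) (h : H) :
    Q.galois act (m ⊗ₜ[k] h) =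
      TensorProduct.map (act.comp (TensorProduct.mk k M H m)) LinearMap.id (Q.comul h) := by
  simp only [galois, freeCoact, LinearMap.comp_apply, LinearEquiv.coe_coe,
    TensorProduct.map_tmul, LinearMap.id_apply]
  induction Q.comul h using TensorProduct.induction_on with
  | zero => simp
  | tmul a b => simp
  | add x y hx hy => simp only [TensorProduct.tmul_add, map_add, hx, hy]

theorem map_counit_smul_comul (m : M) (h : H) :
    TensorProduct.map (LinearMap.smulRight Q.counit m) LinearMap.id (Q.comul h) =
      m ⊗ₜ[k] h := by
  conv_rhs => rw [← Q.counit_comul h]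
  induction Q.comul h using TensorProduct.induction_on with
  | zero => simp
  | tmul a b => simp [TensorProduct.smul_tmul]
  | add x y hx hy => simp only [TensorProduct.tmul_add, map_add, hx, hy]

/-- Coassociativity for the coaction `id ⊗ Δ`, in terms of Galois-type maps. -/
theorem freeCoact_galois (act : M ⊗[k] H →ₗ[k] M) (x : M ⊗[k] H) :
    Q.freeCoact M (Q.galois act x) =
      TensorProduct.map (Q.galois act) LinearMap.id (Q.freeCoact M x) := by
  induction x using TensorProduct.induction_on with
  | zero => simp
  | add x y hx hy => simp only [map_add, hx, hy]
  | tmul m h =>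
    have key := congrArg (fun t => (TensorProduct.assoc k M H H).symm
      (TensorProduct.map (act.comp (TensorProduct.mk k M H m)) LinearMap.id t)) (Q.coassoc h)
    rw [galois_tmul]
    simp only [freeCoact, LinearMap.comp_apply, LinearEquiv.coe_coe,
      TensorProduct.map_tmul, LinearMap.id_apply] at key ⊢
    trans (TensorProduct.assoc k M H H).symm
      (TensorProduct.map (act.comp (TensorProduct.mk k M H m)) LinearMap.id
        (TensorProduct.map LinearMap.id Q.comul (Q.comul h)))
    · induction Q.comul h using TensorProduct.induction_on with
      | zero => simp
      | tmul a b => simp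
      | add x y hx hy => simp only [map_add, hx, hy]
    · rw [← key]
      clear key
      induction Q.comul h using TensorProduct.induction_on with
      | zero => simp
      | add x y hx hy => simp only [TensorProduct.tmul_add, map_add, hx, hy]
      | tmul a b =>
        simp only [TensorProduct.map_tmul, TensorProduct.assoc_symm_tmul, galois_tmul,
          LinearMap.id_apply]
        induction Q.comul a using TensorProduct.induction_on with
        | zero => simp
        | tmul c d => simp
        | add x y hx hy => simp only [TensorProduct.add_tmul, map_add, hx, hy]

theorem galois_galois {act act' : M ⊗[k] H →ₗ[k] M}
    (hact : ∀ m h, act' (Q.galois act (m ⊗ₜ[k] h)) = Q.counit h • m) (x : M ⊗[k] H) :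
    Q.galois act' (Q.galois act x) = x := by
  have hx := Q.freeCoact_galois act x
  rw [galois, LinearMap.comp_apply, hx]
  clear hx
  induction x using TensorProduct.induction_on with
  | zero => simp
  | add x y hx hy => simp only [map_add, hx, hy]
  | tmul m h =>
    simp only [freeCoact, LinearMap.comp_apply, LinearEquiv.coe_coe,
      TensorProduct.map_tmul, LinearMap.id_apply]
    conv_rhs => rw [← Q.map_counit_smul_comul m h]
    induction Q.comul h using TensorProduct.induction_on with
    | zero => simp
    | tmul a b => simp [hact]
    | add x y hx hy => simp only [TensorProduct.tmul_add, map_add, hx, hy]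

theorem rGalois_eq_galois : Q.rGalois = Q.galois (TensorProduct.lift Q.mul) := rfl

theorem lift_mul_galois_antipode (g h : H) :
    TensorProduct.lift Q.mul
      (Q.galois ((TensorProduct.lift Q.mul).comp (TensorProduct.map LinearMap.id Q.S))
        (g ⊗ₜ[k] h)) = Q.counit h • g :=
  Q.antipode₄ g h

theorem antipode_lift_mul_galois (g h : H) :
    (TensorProduct.lift Q.mul).comp (TensorProduct.map LinearMap.id Q.S)
      (Q.galois (TensorProduct.lift Q.mul) (g ⊗ₜ[k] h)) = Q.counit h • g := by
  rw [← Q.antipode₃ g h]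
  simp only [galois, freeCoact, LinearMap.comp_apply, LinearEquiv.coe_coe,
    TensorProduct.map_tmul, LinearMap.id_apply]
  rw [← LinearMap.comp_apply (TensorProduct.map _ _), ← TensorProduct.map_comp]
  rfl

theorem bijective_rGalois : Function.Bijective Q.rGalois :=
  Function.bijective_iff_has_inverse.2
    ⟨_, Q.galois_galois Q.antipode_lift_mul_galois, Q.galois_galois Q.lift_mul_galois_antipode⟩

/-- On elements `m · h` with `ρ(m · h) = m · h₍₁₎ ⊗ h₍₂₎`, the induced action is
`(m · h) ⊳ l = m · (h l)`. -/
theorem inducedAct_act (act : M ⊗[k] H →ₗ[k] M) (ρ : M →ₗ[k] M ⊗[k] H) (m : M)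
    (hρ : ∀ h, ρ (act (m ⊗ₜ[k] h)) = Q.galois act (m ⊗ₜ[k] h))
    (hS : ∀ h, act (TensorProduct.map LinearMap.id Q.S (Q.galois act (m ⊗ₜ[k] h))) =
      Q.counit h • m) (h l : H) :
    Q.inducedAct act ρ (act (m ⊗ₜ[k] h) ⊗ₜ[k] l) = act (m ⊗ₜ[k] Q.mul h l) := by
  have hc : Q.coinvPart act ρ (act (m ⊗ₜ[k] h)) = m ⊗ₜ[k] h := by
    rw [coinvPart, LinearMap.comp_apply, LinearMap.comp_apply, hρ, galois_tmul,
      ← Q.map_counit_smul_comul m h]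
    induction Q.comul h using TensorProduct.induction_on with
    | zero => simp
    | tmul a b => simp [hρ, hS]
    | add x y hx hy => simp only [map_add, hx, hy]
  simp [inducedAct, hc]

theorem lift_mul_map_antipode_comul (h : H) :
    TensorProduct.lift Q.mul (TensorProduct.map LinearMap.id Q.S (Q.comul h)) =
      Q.counit h • Q.one := by
  rw [← Q.antipode₃ Q.one h]
  induction Q.comul h using TensorProduct.induction_on with
  | zero => simp
  | tmul a b => simp [Q.one_mul]
  | add x y hx hy => simp only [TensorProduct.tmul_add, map_add, hx, hy]

theorem lift_mul_antipode_map_comul (h : H) :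
    TensorProduct.lift Q.mul (TensorProduct.map Q.S LinearMap.id (Q.comul h)) =
      Q.counit h • Q.one := by
  rw [← Q.antipode₄ Q.one h]
  induction Q.comul h using TensorProduct.induction_on with
  | zero => simp
  | tmul a b => simp [Q.one_mul]
  | add x y hx hy => simp only [TensorProduct.tmul_add, map_add, hx, hy]

theorem inducedAct_freeAct (g h l : H) :
    Q.inducedAct (Q.freeAct H) (Q.freeCoact H) ((g ⊗ₜ[k] h) ⊗ₜ[k] l) =
      g ⊗ₜ[k] Q.mul h l := by
  have hfree : ∀ h, Q.freeAct H ((g ⊗ₜ[k] Q.one) ⊗ₜ[k] h) = g ⊗ₜ[k] h := fun h => by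
    simp [freeAct, Q.one_mul]
  have hgal : ∀ h, Q.galois (Q.freeAct H) ((g ⊗ₜ[k] Q.one) ⊗ₜ[k] h) =
      (TensorProduct.assoc k H H H).symm (g ⊗ₜ[k] Q.comul h) := fun h => by
    rw [galois_tmul]
    induction Q.comul h using TensorProduct.induction_on with
    | zero => simp
    | tmul a b => simp [hfree]
    | add x y hx hy => simp only [TensorProduct.tmul_add, map_add, hx, hy]
  have := Q.inducedAct_act (Q.freeAct H) (Q.freeCoact H) (g ⊗ₜ[k] Q.one)
    (fun h => by rw [hfree, hgal]; simp [freeCoact])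
    (fun h => by
      rw [hgal, ← TensorProduct.tmul_smul, ← lift_mul_map_antipode_comul]
      induction Q.comul h using TensorProduct.induction_on with
      | zero => simp
      | tmul a b => simp [freeAct]
      | add x y hx hy => simp only [TensorProduct.tmul_add, map_add, hx, hy]) h l
  rwa [hfree, hfree] at this

/-- The map `h ↦ S h₍₂₎ ⊗ S h₍₁₎`. -/
def antipodeSwap : H →ₗ[k] H ⊗[k] H :=
  (TensorProduct.map Q.S Q.S).comp ((TensorProduct.comm k H H).toLinearMap.comp Q.comul)

theorem diagAct_tmul (x : H ⊗[k] H) (h : H) :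
    Q.diagAct (TensorProduct.lift Q.mul) (x ⊗ₜ[k] h) = tmul2 k H Q.mul x (Q.comul h) := by
  simp [diagAct, tmul2]

theorem tmul2_tmul (a b c d : H) :
    tmul2 k H Q.mul (a ⊗ₜ[k] b) (c ⊗ₜ[k] d) = Q.mul a c ⊗ₜ[k] Q.mul b d := by
  simp [tmul2]

/-- Fourfold coassociativity: splitting both legs of `Δ h` agrees with splitting the middle
leg of the threefold coproduct. -/
theorem map_comul_comul (h : H) :
    TensorProduct.map Q.comul Q.comul (Q.comul h) =
      TensorProduct.assoc k (H ⊗[k] H) H H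
        (TensorProduct.map ((TensorProduct.assoc k H H H).symm.toLinearMap.comp
          ((TensorProduct.map LinearMap.id Q.comul).comp Q.comul)) LinearMap.id (Q.comul h)) := by
  have h₁ : TensorProduct.map Q.comul Q.comul (Q.comul h) =
      TensorProduct.map Q.comul LinearMap.id
        (TensorProduct.map LinearMap.id Q.comul (Q.comul h)) := by
    rw [← LinearMap.comp_apply (TensorProduct.map Q.comul LinearMap.id), ← TensorProduct.map_comp]
    rfl
  rw [h₁, ← Q.coassoc]
  induction Q.comul h using TensorProduct.induction_on with
  | zero => simp
  | add x y hx hy => simp only [map_add, hx, hy]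
  | tmul a b =>
    simp only [TensorProduct.map_tmul, LinearMap.comp_apply, LinearEquiv.coe_coe,
      LinearMap.id_apply, ← Q.coassoc, LinearEquiv.symm_apply_apply]
    induction Q.comul a using TensorProduct.induction_on with
    | zero => simp
    | tmul c d => simp
    | add x y hx hy => simp only [TensorProduct.add_tmul, map_add, hx, hy]

/-- `(x Δ(h₍₁₎)) (S h₍₃₎ ⊗ S h₍₂₎) = ε(h) x` in `H ⊗ H`. -/
theorem tmul2_antipodeSwap (x : H ⊗[k] H) (h : H) :
    TensorProduct.lift (tmul2 k H Q.mul)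
      (TensorProduct.map (tmul2 k H Q.mul x) LinearMap.id
        (TensorProduct.map Q.comul Q.antipodeSwap (Q.comul h))) = Q.counit h • x := by
  induction x using TensorProduct.induction_on with
  | zero =>
    simp only [map_zero, smul_zero]
    induction Q.comul h using TensorProduct.induction_on with
    | zero => simp
    | tmul a b => simp
    | add x y hx hy => simp only [map_add, hx, hy, add_zero]
  | add x y hx hy =>
    rw [smul_add, ← hx, ← hy, map_add, TensorProduct.map_add_left, LinearMap.add_apply, map_add]
  | tmul a b =>
    have hsplit : TensorProduct.map Q.comul Q.antipodeSwap (Q.comul h) =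
        TensorProduct.map LinearMap.id
          ((TensorProduct.map Q.S Q.S).comp (TensorProduct.comm k H H).toLinearMap)
          (TensorProduct.map Q.comul Q.comul (Q.comul h)) := by
      rw [← LinearMap.comp_apply (TensorProduct.map LinearMap.id _), ← TensorProduct.map_comp]
      rfl
    rw [hsplit, map_comul_comul, TensorProduct.smul_tmul', ← Q.antipode₃ a h]
    clear hsplit
    induction Q.comul h using TensorProduct.induction_on with
    | zero => simp
    | add x y hx hy => simp only [TensorProduct.tmul_add, TensorProduct.add_tmul, map_add, hx, hy]
    | tmul c d =>
      have hc := congrArg (fun t => Q.mul (Q.mul a t) (Q.S d) ⊗ₜ[k] b) (Q.comul_counit c)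
      simp only [TensorProduct.map_tmul, TensorProduct.assoc_symm_tmul, TensorProduct.lift.tmul,
        LinearMap.comp_apply, LinearEquiv.coe_coe, LinearMap.id_apply]
      rw [← hc]
      clear hc
      induction Q.comul c using TensorProduct.induction_on with
      | zero => simp
      | add x y hx hy =>
        simp only [TensorProduct.add_tmul, map_add, LinearMap.add_apply, hx, hy]
      | tmul e f =>
        have hf := Q.antipode₃ b f
        simp only [TensorProduct.map_tmul, TensorProduct.rid_tmul, LinearMap.id_apply, map_smul,
          LinearMap.smul_apply, TensorProduct.smul_tmul, ← hf]
        clear hf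
        induction Q.comul f using TensorProduct.induction_on with
        | zero => simp
        | tmul u v => simp [tmul2_tmul]
        | add x y hx hy =>
          simp only [TensorProduct.tmul_add, TensorProduct.add_tmul, map_add, hx, hy]

/-- The antipode of a Hopf quasigroup reverses the coproduct:
`Δ(S h) = S h₍₂₎ ⊗ S h₍₁₎`. -/
theorem comul_antipode (h : H) : Q.comul (Q.S h) = Q.antipodeSwap h := by
  set F : H ⊗[k] (H ⊗[k] H) →ₗ[k] H ⊗[k] H :=
    (TensorProduct.lift (tmul2 k H Q.mul)).comp
      ((TensorProduct.map (TensorProduct.lift (tmul2 k H Q.mul)) LinearMap.id).comp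
        ((TensorProduct.assoc k _ _ _).symm.toLinearMap.comp
          (TensorProduct.map (Q.comul.comp Q.S) (TensorProduct.map Q.comul Q.antipodeSwap))))
    with hF
  have hr : F (TensorProduct.map LinearMap.id Q.comul (Q.comul h)) = Q.comul (Q.S h) := by
    conv_rhs => rw [← Q.comul_counit h]
    induction Q.comul h using TensorProduct.induction_on with
    | zero => simp
    | add x y hx hy => simp only [map_add, hx, hy]
    | tmul a b =>
      simp only [TensorProduct.map_tmul, TensorProduct.rid_tmul, LinearMap.id_apply, map_smul,
        ← tmul2_antipodeSwap]
      induction Q.comul b using TensorProduct.induction_on with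
      | zero => simp
      | tmul c d => simp [hF]
      | add x y hx hy => simp only [TensorProduct.tmul_add, map_add, hx, hy]
  have hl : F (TensorProduct.assoc k H H H
      (TensorProduct.map Q.comul LinearMap.id (Q.comul h))) = Q.antipodeSwap h := by
    conv_rhs => rw [← Q.counit_comul h]
    induction Q.comul h using TensorProduct.induction_on with
    | zero => simp
    | add x y hx hy => simp only [map_add, hx, hy]
    | tmul a b =>
      have ha : tmul2 k H Q.mul (Q.counit a • Q.one ⊗ₜ[k] Q.one) (Q.antipodeSwap b) =
          Q.counit a • Q.antipodeSwap b := by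
        rw [map_smul, LinearMap.smul_apply]
        congr 1
        induction Q.antipodeSwap b using TensorProduct.induction_on with
        | zero => simp
        | tmul c d => simp [tmul2_tmul, Q.one_mul]
        | add x y hx hy => simp only [map_add, hx, hy]
      simp only [TensorProduct.map_tmul, TensorProduct.lid_tmul, LinearMap.id_apply, map_smul]
      rw [← ha, ← Q.comul_one, ← map_smul, ← lift_mul_antipode_map_comul]
      clear ha
      induction Q.comul a using TensorProduct.induction_on with
      | zero => simp
      | tmul c d => simp [hF, Q.comul_mul]
      | add x y hx hy =>
        simp only [TensorProduct.add_tmul, map_add, LinearMap.add_apply, hx, hy]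
  rw [← hr, ← hl, Q.coassoc]

theorem diagAct_tmul_one (g h : H) :
    Q.diagAct (TensorProduct.lift Q.mul) ((g ⊗ₜ[k] Q.one) ⊗ₜ[k] h) =
      Q.rGalois (g ⊗ₜ[k] h) := by
  rw [rGalois_eq_galois, galois_tmul, diagAct_tmul]
  induction Q.comul h using TensorProduct.induction_on with
  | zero => simp
  | tmul a b => simp [tmul2_tmul, Q.one_mul]
  | add x y hx hy => simp only [map_add, hx, hy]

theorem inducedAct_diagAct_rGalois (g h l : H) :
    Q.inducedAct (Q.diagAct (TensorProduct.lift Q.mul)) (Q.freeCoact H)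
      (Q.rGalois (g ⊗ₜ[k] h) ⊗ₜ[k] l) = Q.rGalois (g ⊗ₜ[k] Q.mul h l) := by
  have := Q.inducedAct_act (Q.diagAct (TensorProduct.lift Q.mul)) (Q.freeCoact H)
    (g ⊗ₜ[k] Q.one)
    (fun h => by
      rw [diagAct_tmul_one, rGalois_eq_galois, freeCoact_galois, galois_tmul]
      simp only [freeCoact, LinearMap.comp_apply, LinearEquiv.coe_coe,
        TensorProduct.map_tmul, LinearMap.id_apply]
      induction Q.comul h using TensorProduct.induction_on with
      | zero => simp
      | tmul a b => simp [diagAct_tmul_one, rGalois_eq_galois]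
      | add x y hx hy => simp only [TensorProduct.tmul_add, map_add, hx, hy])
    (fun h => by
      rw [← tmul2_antipodeSwap, galois_tmul]
      induction Q.comul h using TensorProduct.induction_on with
      | zero => simp
      | tmul a b => simp [diagAct_tmul, comul_antipode]
      | add x y hx hy => simp only [map_add, hx, hy]) h l
  rwa [diagAct_tmul_one, diagAct_tmul_one] at this

theorem freeCoact_eq_tmul_one_iff (x : M ⊗[k] H) :
    Q.freeCoact M x = x ⊗ₜ[k] Q.one ↔ ∃ m : M, x = m ⊗ₜ[k] Q.one := by
  constructor
  · intro hx
    set E : M ⊗[k] H →ₗ[k] M :=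
      (TensorProduct.rid k M).toLinearMap.comp (TensorProduct.map LinearMap.id Q.counit) with hE
    have hid : TensorProduct.map E LinearMap.id (Q.freeCoact M x) = x := by
      clear hx
      induction x using TensorProduct.induction_on with
      | zero => simp
      | add x y hx hy => simp only [map_add, hx, hy]
      | tmul m h =>
        conv_rhs => rw [← Q.map_counit_smul_comul m h]
        simp only [freeCoact, LinearMap.comp_apply, LinearEquiv.coe_coe,
          TensorProduct.map_tmul, LinearMap.id_apply]
        induction Q.comul h using TensorProduct.induction_on with
        | zero => simp
        | tmul a b => simp [hE]
        | add x y hx hy => simp only [TensorProduct.tmul_add, map_add, hx, hy]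
    exact ⟨E x, by rw [hx] at hid; simpa using hid.symm⟩
  · rintro ⟨m, rfl⟩
    simp [freeCoact, Q.comul_one]

end HopfQuasigroup

/-- The right Galois map `β` is an isomorphism of right `H`-Hopf modules from
the free structure on `H ⊗ H` to the diagonal structure: it is bijective, right `H`-colinear
and `H`-quasilinear; moreover the coinvariants of the diagonal structure are `H ⊗ 1`. -/
theorem stmt16 {k : Type*} [Field k] {H : Type*} [AddCommGroup H] [Module k H]
    (Q : HopfQuasigroup k H) :
    Function.Bijective ⇑Q.toBialgQ.rGalois ∧
    (∀ x : H ⊗[k] H, Q.freeCoact H (Q.toBialgQ.rGalois x) =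
        TensorProduct.map Q.toBialgQ.rGalois LinearMap.id (Q.freeCoact H x)) ∧
    (∀ (x : H ⊗[k] H) (h : H),
        Q.toBialgQ.rGalois (Q.inducedAct (Q.freeAct H) (Q.freeCoact H) (x ⊗ₜ[k] h)) =
        Q.inducedAct (Q.diagAct (TensorProduct.lift Q.mul)) (Q.freeCoact H)
          (Q.toBialgQ.rGalois x ⊗ₜ[k] h)) ∧
    (∀ x : H ⊗[k] H, Q.freeCoact H x = x ⊗ₜ[k] Q.one ↔ ∃ g : H, x = g ⊗ₜ[k] Q.one) := by
  refine ⟨Q.bijective_rGalois, Q.freeCoact_galois _, fun x h => ?_, Q.freeCoact_eq_tmul_one_iff⟩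
  induction x using TensorProduct.induction_on with
  | zero => simp
  | add x y hx hy => simp only [TensorProduct.add_tmul, map_add, hx, hy]
  | tmul a b => rw [Q.inducedAct_freeAct, Q.inducedAct_diagAct_rGalois]
end
end

section
/- Let H be a Hopf coquasigroup and M a right H-Hopf module with action (m,h) ↦ m·h and coaction ρ. Let M^H be the quotient of M by the subspace spanned by all elements m·h − ε(h)m (m ∈ M, h ∈ H), with quotient map π : M → M^H. Then: (a) there is a well-defined linear map η⁻¹ : M^H⊗H → M determined by π(m)⊗h ↦ m₍₀₎·((Sm₍₁₎)h); and (b) the linear map η : M → M^H⊗H, m ↦ π(m₍₀₎)⊗m₍₁₎, is bijective with inverse η⁻¹. -/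
open TensorProduct

noncomputable section

/-- The subspace of `M` spanned by the elements `m·h - ε(h) m`. -/
def actionSpan {k : Type*} [Field k] {H : Type*} [AddCommGroup H] [Module k H]
    (Q : HopfCoquasigroup k H) {M : Type*} [AddCommGroup M] [Module k M]
    (act : M ⊗[k] H →ₗ[k] M) : Submodule k M :=
  Submodule.span k {x : M | ∃ (m : M) (h : H), x = act (m ⊗ₜ[k] h) - Q.counit h • m}

@[simp]
theorem tmul2_tmul {k : Type*} [Field k] {H : Type*} [AddCommGroup H] [Module k H]
    (mul : H →ₗ[k] H →ₗ[k] H) (a b c d : H) :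
    tmul2 k H mul (a ⊗ₜ[k] b) (c ⊗ₜ[k] d) = mul a c ⊗ₜ[k] mul b d := rfl

namespace BialgQ

variable {k : Type*} [Field k] {H : Type*} [AddCommGroup H] [Module k H] (D : BialgQ k H)

/-- `id ⊗ ε : H ⊗ H → H`. -/
def idCounit : H ⊗[k] H →ₗ[k] H :=
  (TensorProduct.rid k H).toLinearMap.comp (TensorProduct.map LinearMap.id D.counit)

@[simp]
theorem idCounit_tmul (a b : H) : D.idCounit (a ⊗ₜ[k] b) = D.counit b • a := by
  simp [idCounit]

@[simp]
theorem idCounit_comul (h : H) : D.idCounit (D.comul h) = h := D.comul_counit h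

theorem rGalois_tmul (g h : H) :
    D.rGalois (g ⊗ₜ[k] h) = TensorProduct.map (D.mul g) LinearMap.id (D.comul h) := by
  simp only [rGalois, LinearMap.comp_apply, TensorProduct.map_tmul, LinearMap.id_apply,
    LinearEquiv.coe_coe]
  induction D.comul h using TensorProduct.induction_on with
  | zero => simp
  | tmul x y => simp [mulMap]
  | add x y hx hy => simp only [tmul_add, map_add, hx, hy]

theorem betaInvOf_tmul (S : H →ₗ[k] H) (g h : H) :
    D.betaInvOf S (g ⊗ₜ[k] h) =
      TensorProduct.map ((D.mul g).comp S) LinearMap.id (D.comul h) := by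
  simp only [betaInvOf, LinearMap.comp_apply, TensorProduct.map_tmul, LinearMap.id_apply,
    LinearEquiv.coe_coe]
  induction D.comul h using TensorProduct.induction_on with
  | zero => simp
  | tmul x y => simp [mulMap]
  | add x y hx hy => simp only [tmul_add, map_add, hx, hy]

theorem idCounit_betaInvOf_one (S : H →ₗ[k] H) (h : H) :
    D.idCounit (D.betaInvOf S (D.one ⊗ₜ[k] h)) = S h := by
  rw [betaInvOf_tmul]
  conv_rhs => rw [← D.idCounit_comul h]
  induction D.comul h using TensorProduct.induction_on with
  | zero => simp
  | tmul x y => simp [D.one_mul]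
  | add x y hx hy => simp only [map_add, hx, hy]

/-- The linear map with `(a ⊗ b) ⊗ (c ⊗ d) ↦ (S c)(S a) ⊗ b d`. -/
def antiProd (S : H →ₗ[k] H) : (H ⊗[k] H) ⊗[k] (H ⊗[k] H) →ₗ[k] H ⊗[k] H :=
  (TensorProduct.map ((TensorProduct.lift D.mul.flip).comp (TensorProduct.map S S))
      (TensorProduct.lift D.mul)).comp
    (TensorProduct.tensorTensorTensorComm k H H H H).toLinearMap

@[simp]
theorem antiProd_tmul (S : H →ₗ[k] H) (a b c d : H) :
    D.antiProd S ((a ⊗ₜ[k] b) ⊗ₜ[k] (c ⊗ₜ[k] d)) =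
      D.mul (S c) (S a) ⊗ₜ[k] D.mul b d := by
  simp [antiProd]

theorem idCounit_antiProd (S : H →ₗ[k] H) (s t : H ⊗[k] H) :
    D.idCounit (D.antiProd S (s ⊗ₜ[k] t)) = D.mul (S (D.idCounit t)) (S (D.idCounit s)) := by
  induction s using TensorProduct.induction_on with
  | zero => simp
  | add x y hx hy => simp only [add_tmul, map_add, hx, hy]
  | tmul a b =>
    induction t using TensorProduct.induction_on with
    | zero => simp
    | add x y hx hy => simp only [tmul_add, map_add, hx, hy, LinearMap.add_apply]
    | tmul c d => simp [D.counit_mul, smul_smul]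

end BialgQ

namespace HopfCoquasigroup

variable {k : Type*} [Field k] {H : Type*} [AddCommGroup H] [Module k H]
  (Q : HopfCoquasigroup k H)

theorem tmul2_assoc (r s t : H ⊗[k] H) :
    tmul2 k H Q.mul (tmul2 k H Q.mul r s) t = tmul2 k H Q.mul r (tmul2 k H Q.mul s t) := by
  induction r using TensorProduct.induction_on with
  | zero => simp
  | add x y hx hy => simp only [map_add, LinearMap.add_apply, hx, hy]
  | tmul a b =>
    induction s using TensorProduct.induction_on with
    | zero => simp
    | add x y hx hy => simp only [map_add, LinearMap.add_apply, hx, hy]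
    | tmul c d =>
      induction t using TensorProduct.induction_on with
      | zero => simp
      | add x y hx hy => simp only [map_add, hx, hy]
      | tmul e f => simp [Q.mul_assoc]

theorem map_mul_eq_tmul2 (a b : H) (t : H ⊗[k] H) :
    TensorProduct.map (Q.mul a) (Q.mul b) t = tmul2 k H Q.mul (a ⊗ₜ[k] b) t := by
  induction t using TensorProduct.induction_on with
  | zero => simp
  | add x y hx hy => simp only [map_add, hx, hy]
  | tmul c d => simp

theorem mul_one_eq_id : Q.mul Q.one = LinearMap.id := LinearMap.ext Q.one_mul

theorem rGalois_tmul (g h : H) :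
    Q.rGalois (g ⊗ₜ[k] h) = tmul2 k H Q.mul (g ⊗ₜ[k] Q.one) (Q.comul h) := by
  rw [← map_mul_eq_tmul2, mul_one_eq_id, BialgQ.rGalois_tmul]

theorem betaInvOf_map_mul (g : H) (t : H ⊗[k] H) :
    Q.betaInvOf Q.S (TensorProduct.map (Q.mul g) LinearMap.id t) =
      TensorProduct.map (Q.mul g) LinearMap.id (Q.betaInvOf Q.S t) := by
  induction t using TensorProduct.induction_on with
  | zero => simp
  | add x y hx hy => simp only [map_add, hx, hy]
  | tmul a b =>
    have h : (Q.mul (Q.mul g a)).comp Q.S = (Q.mul g).comp ((Q.mul a).comp Q.S) :=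
      LinearMap.ext fun x => Q.mul_assoc g a (Q.S x)
    rw [TensorProduct.map_tmul, BialgQ.betaInvOf_tmul, BialgQ.betaInvOf_tmul, h,
      TensorProduct.map_map, LinearMap.id_comp, LinearMap.id_apply]

/-- The map `g ⊗ h ↦ g S(h₍₁₎) ⊗ h₍₂₎` is a left inverse of the right Galois map. -/
theorem betaInvOf_rGalois (x : H ⊗[k] H) : Q.betaInvOf Q.S (Q.rGalois x) = x := by
  induction x using TensorProduct.induction_on with
  | zero => simp
  | add x y hx hy => simp only [map_add, hx, hy]
  | tmul g h =>
    have hc : Q.betaInvOf Q.S (Q.comul h) = Q.one ⊗ₜ[k] h := Q.coantipode₂ h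
    rw [BialgQ.rGalois_tmul, betaInvOf_map_mul, hc]
    simp [Q.mul_one]

/-- `(S h₍₁₎) h₍₂₎₍₁₎ ⊗ h₍₂₎₍₂₎ = 1 ⊗ h`, in terms of the right Galois map. -/
theorem rGalois_map_antipode_comul (h : H) :
    Q.rGalois (TensorProduct.map Q.S LinearMap.id (Q.comul h)) = Q.one ⊗ₜ[k] h := by
  rw [← Q.coantipode₁ h]
  induction Q.comul h using TensorProduct.induction_on with
  | zero => simp
  | add x y hx hy => simp only [map_add, hx, hy]
  | tmul a b =>
    simp only [BialgQ.rGalois_tmul, TensorProduct.map_tmul, LinearMap.id_apply]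
    induction Q.comul b using TensorProduct.induction_on with
    | zero => simp
    | tmul x y => simp
    | add x y hx hy => simp only [tmul_add, map_add, hx, hy]

theorem rGalois_antiProd_tmul (s : H ⊗[k] H) (c d : H) :
    Q.rGalois (Q.antiProd Q.S (s ⊗ₜ[k] (c ⊗ₜ[k] d))) =
      tmul2 k H Q.mul (tmul2 k H Q.mul (Q.S c ⊗ₜ[k] Q.one)
        (Q.rGalois (TensorProduct.map Q.S LinearMap.id s))) (Q.comul d) := by
  induction s using TensorProduct.induction_on with
  | zero => simp
  | add x y hx hy => simp only [add_tmul, map_add, LinearMap.add_apply, hx, hy]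
  | tmul a b =>
    simp only [BialgQ.antiProd_tmul, TensorProduct.map_tmul, LinearMap.id_apply, rGalois_tmul,
      Q.comul_mul, ← tmul2_assoc, tmul2_tmul, Q.one_mul]

theorem rGalois_antiProd_comul (g : H) (t : H ⊗[k] H) :
    Q.rGalois (Q.antiProd Q.S (Q.comul g ⊗ₜ[k] t)) =
      TensorProduct.map LinearMap.id (Q.mul g)
        (Q.rGalois (TensorProduct.map Q.S LinearMap.id t)) := by
  induction t using TensorProduct.induction_on with
  | zero => simp
  | add x y hx hy => simp only [tmul_add, map_add, hx, hy]
  | tmul c d =>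
    rw [rGalois_antiProd_tmul, rGalois_map_antipode_comul, ← mul_one_eq_id, map_mul_eq_tmul2,
      TensorProduct.map_tmul, rGalois_tmul, ← tmul2_assoc]
    simp [Q.one_mul, Q.mul_one]

/-- The antipode of a Hopf coquasigroup is antimultiplicative. -/
theorem antipode_mul (g h : H) : Q.S (Q.mul g h) = Q.mul (Q.S h) (Q.S g) := by
  have key : Q.rGalois (Q.antiProd Q.S (Q.comul g ⊗ₜ[k] Q.comul h)) =
      Q.one ⊗ₜ[k] Q.mul g h := by
    rw [rGalois_antiProd_comul, rGalois_map_antipode_comul]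
    simp
  rw [← Q.idCounit_betaInvOf_one Q.S (Q.mul g h), ← key, betaInvOf_rGalois,
    BialgQ.idCounit_antiProd, BialgQ.idCounit_comul, BialgQ.idCounit_comul]

/-- `h₍₁₎ S h₍₂₎ = ε(h) 1`. -/
theorem lift_mul_antipode_comul (h : H) :
    TensorProduct.lift Q.mul (TensorProduct.map LinearMap.id Q.S (Q.comul h)) =
      Q.counit h • Q.one := by
  have hc : Q.betaInvOf Q.S (Q.comul h) = Q.one ⊗ₜ[k] h := Q.coantipode₂ h
  have hε := congrArg Q.idCounit hc
  rw [BialgQ.idCounit_tmul] at hε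
  rw [← hε]
  induction Q.comul h using TensorProduct.induction_on with
  | zero => simp
  | add x y hx hy => simp only [map_add, hx, hy]
  | tmul a b =>
    rw [BialgQ.betaInvOf_tmul, TensorProduct.map_tmul, TensorProduct.lift.tmul]
    conv_lhs => rw [← Q.idCounit_comul b]
    induction Q.comul b using TensorProduct.induction_on with
    | zero => simp
    | add x y hx hy => simp only [map_add, hx, hy]
    | tmul x y => simp

end HopfCoquasigroup

namespace HopfCoquasigroup.IsHopfModule

variable {k : Type*} [Field k] {H : Type*} [AddCommGroup H] [Module k H]
  {Q : HopfCoquasigroup k H} {M : Type*} [AddCommGroup M] [Module k M]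
  {act : M ⊗[k] H →ₗ[k] M} {ρ : M →ₗ[k] M ⊗[k] H}

theorem act_one (hM : Q.IsHopfModule act ρ) (m : M) : act (m ⊗ₜ[k] Q.one) = m := hM.1 m

theorem act_act (hM : Q.IsHopfModule act ρ) (m : M) (g h : H) :
    act (act (m ⊗ₜ[k] g) ⊗ₜ[k] h) = act (m ⊗ₜ[k] Q.mul g h) := hM.2.1 m g h

theorem coact_mul_antipode (hM : Q.IsHopfModule act ρ) (m : M) :
    TensorProduct.map LinearMap.id
      ((TensorProduct.lift Q.mul).comp (TensorProduct.map LinearMap.id Q.S))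
      (TensorProduct.assoc k M H H (TensorProduct.map ρ LinearMap.id (ρ m)))
      = m ⊗ₜ[k] Q.one := hM.2.2.2.1 m

theorem coact_antipode_mul (hM : Q.IsHopfModule act ρ) (m : M) :
    TensorProduct.map LinearMap.id
      ((TensorProduct.lift Q.mul).comp (TensorProduct.map Q.S LinearMap.id))
      (TensorProduct.assoc k M H H (TensorProduct.map ρ LinearMap.id (ρ m)))
      = m ⊗ₜ[k] Q.one := hM.2.2.2.2.1 m

theorem coact_act (hM : Q.IsHopfModule act ρ) (m : M) (h : H) :
    ρ (act (m ⊗ₜ[k] h)) = TensorProduct.map act (TensorProduct.lift Q.mul)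
      (TensorProduct.tensorTensorTensorComm k M H H H (ρ m ⊗ₜ[k] Q.comul h)) :=
  hM.2.2.2.2.2 m h

variable (Q act ρ) in
/-- The bilinear map `(m, h) ↦ m₍₀₎ · ((S m₍₁₎) h)`. -/
def antipodeAct : M →ₗ[k] H →ₗ[k] M :=
  TensorProduct.curry (act.comp ((TensorProduct.map LinearMap.id
    ((TensorProduct.lift Q.mul).comp (TensorProduct.map Q.S LinearMap.id))).comp
      ((TensorProduct.assoc k M H H).toLinearMap.comp (TensorProduct.map ρ LinearMap.id))))

theorem antipodeAct_apply (m : M) (h : H) :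
    antipodeAct Q act ρ m h =
      act (TensorProduct.map LinearMap.id ((Q.mul.flip h).comp Q.S) (ρ m)) := by
  simp only [antipodeAct, TensorProduct.curry_apply, LinearMap.comp_apply,
    TensorProduct.map_tmul, LinearMap.id_apply, LinearEquiv.coe_coe]
  induction ρ m using TensorProduct.induction_on with
  | zero => simp
  | add x y hx hy => simp only [add_tmul, map_add, hx, hy]
  | tmul x y => simp

theorem act_map_antipode_diag (hM : Q.IsHopfModule act ρ) (h x : H) (n : M) (t : H ⊗[k] H) :
    act (TensorProduct.map LinearMap.id ((Q.mul.flip h).comp Q.S)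
      (TensorProduct.map act (TensorProduct.lift Q.mul)
        (TensorProduct.tensorTensorTensorComm k M H H H ((n ⊗ₜ[k] x) ⊗ₜ[k] t)))) =
      act (n ⊗ₜ[k] Q.mul (TensorProduct.lift Q.mul (TensorProduct.map LinearMap.id Q.S t))
        (Q.mul (Q.S x) h)) := by
  induction t using TensorProduct.induction_on with
  | zero => simp
  | add x y hx hy => simp only [tmul_add, map_add, LinearMap.add_apply, hx, hy]
  | tmul a b => simp [hM.act_act, Q.antipode_mul, Q.mul_assoc]

theorem antipodeAct_act (hM : Q.IsHopfModule act ρ) (m : M) (g h : H) :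
    antipodeAct Q act ρ (act (m ⊗ₜ[k] g)) h = Q.counit g • antipodeAct Q act ρ m h := by
  rw [antipodeAct_apply, antipodeAct_apply, hM.coact_act]
  induction ρ m using TensorProduct.induction_on with
  | zero => simp
  | add x y hx hy => simp only [add_tmul, map_add, smul_add, hx, hy]
  | tmul n x =>
    rw [hM.act_map_antipode_diag, Q.lift_mul_antipode_comul]
    simp [Q.one_mul]

theorem actionSpan_le_ker (hM : Q.IsHopfModule act ρ) :
    actionSpan Q act ≤ LinearMap.ker (antipodeAct Q act ρ) := by
  refine Submodule.span_le.2 ?_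
  rintro _ ⟨m, g, rfl⟩
  ext h
  simp [hM.antipodeAct_act]

theorem mkQ_act (m : M) (h : H) :
    (actionSpan Q act).mkQ (act (m ⊗ₜ[k] h)) = Q.counit h • (actionSpan Q act).mkQ m := by
  rw [← map_smul, ← sub_eq_zero, ← map_sub, Submodule.mkQ_apply, Submodule.Quotient.mk_eq_zero]
  exact Submodule.subset_span ⟨m, h, rfl⟩

theorem map_mkQ_diag (r : M ⊗[k] H) (t : H ⊗[k] H) :
    TensorProduct.map (actionSpan Q act).mkQ LinearMap.id
      (TensorProduct.map act (TensorProduct.lift Q.mul)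
        (TensorProduct.tensorTensorTensorComm k M H H H (r ⊗ₜ[k] t))) =
      TensorProduct.map (actionSpan Q act).mkQ (Q.mul.flip
        (TensorProduct.lid k H (TensorProduct.map Q.counit LinearMap.id t))) r := by
  induction r using TensorProduct.induction_on with
  | zero => simp
  | add x y hx hy => simp only [add_tmul, map_add, hx, hy]
  | tmul n x =>
    induction t using TensorProduct.induction_on with
    | zero => simp
    | add x y hx hy =>
      simp only [tmul_add, map_add, hx, hy, TensorProduct.map_tmul, LinearMap.add_apply]
    | tmul a b =>
      simp only [TensorProduct.tensorTensorTensorComm_tmul, TensorProduct.map_tmul, mkQ_act]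
      simp [smul_tmul]

/-- `π(m₍₀₎) ⊗ m₍₁₎` for `m` replaced by `m · h` is `π(m₍₀₎) ⊗ m₍₁₎ h`. -/
theorem map_mkQ_coact_act (hM : Q.IsHopfModule act ρ) (m : M) (h : H) :
    TensorProduct.map (actionSpan Q act).mkQ LinearMap.id (ρ (act (m ⊗ₜ[k] h))) =
      TensorProduct.map (actionSpan Q act).mkQ (Q.mul.flip h) (ρ m) := by
  rw [hM.coact_act, map_mkQ_diag, Q.counit_comul]

theorem map_mkQ_coact_antipodeAct (hM : Q.IsHopfModule act ρ) (m : M) (h : H) :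
    TensorProduct.map (actionSpan Q act).mkQ LinearMap.id (ρ (antipodeAct Q act ρ m h)) =
      (actionSpan Q act).mkQ m ⊗ₜ[k] h := by
  have hm := congrArg (TensorProduct.map (actionSpan Q act).mkQ (Q.mul.flip h))
    (hM.coact_mul_antipode m)
  rw [TensorProduct.map_tmul, LinearMap.flip_apply, Q.one_mul] at hm
  rw [antipodeAct_apply, ← hm]
  induction ρ m using TensorProduct.induction_on with
  | zero => simp
  | add x y hx hy => simp only [map_add, hx, hy]
  | tmul n c =>
    simp only [TensorProduct.map_tmul, LinearMap.id_apply, hM.map_mkQ_coact_act]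
    induction ρ n using TensorProduct.induction_on with
    | zero => simp
    | add x y hx hy => simp only [add_tmul, map_add, hx, hy]
    | tmul x y => simp [Q.mul_assoc]

/-- `m₍₀₎₍₀₎ · ((S m₍₀₎₍₁₎) m₍₁₎) = m`. -/
theorem lift_antipodeAct_coact (hM : Q.IsHopfModule act ρ) (m : M) :
    TensorProduct.lift (antipodeAct Q act ρ) (ρ m) = m := by
  have hm := congrArg act (hM.coact_antipode_mul m)
  rw [hM.act_one] at hm
  have lift_curry (f : M ⊗[k] H →ₗ[k] M) : TensorProduct.lift (TensorProduct.curry f) = f :=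
    TensorProduct.ext' fun _ _ => rfl
  rw [antipodeAct, lift_curry]
  exact hm

end HopfCoquasigroup.IsHopfModule

/-- For a right Hopf module `M` over a Hopf coquasigroup, with
`M^H = M / span{m·h - ε(h)m}` and quotient map `π`: (a) there is a (unique) well-defined
linear map `η⁻¹ : M^H ⊗ H → M` with `π(m) ⊗ h ↦ m₍₀₎·((Sm₍₁₎)h)`; and (b) the map
`η : m ↦ π(m₍₀₎) ⊗ m₍₁₎` is bijective with inverse `η⁻¹`. -/
theorem stmt19 {k : Type*} [Field k] {H : Type*} [AddCommGroup H] [Module k H]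
    (Q : HopfCoquasigroup k H) {M : Type*} [AddCommGroup M] [Module k M]
    (act : M ⊗[k] H →ₗ[k] M) (ρ : M →ₗ[k] M ⊗[k] H)
    (hM : Q.IsHopfModule act ρ) :
    (∃! e : (M ⧸ actionSpan Q act) ⊗[k] H →ₗ[k] M,
      ∀ (m : M) (h : H), e ((actionSpan Q act).mkQ m ⊗ₜ[k] h) =
        act (TensorProduct.map LinearMap.id ((Q.mul.flip h).comp Q.S) (ρ m))) ∧
    (∀ e : (M ⧸ actionSpan Q act) ⊗[k] H →ₗ[k] M,
      (∀ (m : M) (h : H), e ((actionSpan Q act).mkQ m ⊗ₜ[k] h) =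
        act (TensorProduct.map LinearMap.id ((Q.mul.flip h).comp Q.S) (ρ m))) →
      (∀ m : M,
        e (TensorProduct.map (actionSpan Q act).mkQ LinearMap.id (ρ m)) = m) ∧
      (∀ x : (M ⧸ actionSpan Q act) ⊗[k] H,
        TensorProduct.map (actionSpan Q act).mkQ LinearMap.id (ρ (e x)) = x)) := by
  open HopfCoquasigroup.IsHopfModule in
  simp only [← antipodeAct_apply]
  refine ⟨⟨TensorProduct.lift ((actionSpan Q act).liftQ _ hM.actionSpan_le_ker),
    fun m h => by simp, fun e he => ?_⟩, fun e he => ⟨fun m => ?_, fun x => ?_⟩⟩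
  · ext m h
    simpa using he m h
  · have hcomp : e.comp (TensorProduct.map (actionSpan Q act).mkQ LinearMap.id) =
        TensorProduct.lift (antipodeAct Q act ρ) := by
      ext m h
      simpa using he m h
    rw [← LinearMap.comp_apply, hcomp, hM.lift_antipodeAct_coact]
  · induction x using TensorProduct.induction_on with
    | zero => simp
    | add x y hx hy => simp only [map_add, hx, hy]
    | tmul q h =>
      obtain ⟨m, rfl⟩ := (actionSpan Q act).mkQ_surjective q
      rw [he, hM.map_mkQ_coact_antipodeAct]
end
end
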